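/- arXiv:2210.00665 — 7 statements merged into one kernel-verified Lean document; each statement's English description precedes it below -/
import Mathlib

section
/- Let a, b, k be natural numbers with a + b ≥ 1 and 2k < a + b. Define the integer T_k = (a − min(a,k) − max(k − b, 0)) − (b − min(b,k) − max(k − a, 0)). Then sign(T_k) = sign(a − b), where sign : ℤ → {−1, 0, 1} is the usual sign function. (Consequently, for a list of n = a + b values in {−1, 1} with a ones and b minus-ones, the sign of the k-trimmed sum — obtained by removing the k largest and k smallest entries and summing the remainder — is the same for every k with 2k < n; in particular the signs of the simple mean (k = 0), the coordinate-wise median (k = ⌈n/2⌉ − 1), and the majority vote all coincide.) -/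
/-- For natural numbers `a, b, k` with `a + b ≥ 1` and `2k < a + b`, the sign of the
`k`-trimmed sum `T_k = (a − min(a,k) − max(k − b, 0)) − (b − min(b,k) − max(k − a, 0))`
equals the sign of `a − b`. -/
theorem trimmed_sum_sign_eq (a b k : ℕ) (h1 : 1 ≤ a + b) (h2 : 2 * k < a + b) :
    Int.sign (((a : ℤ) - min (a : ℤ) (k : ℤ) - max ((k : ℤ) - (b : ℤ)) 0) -
        ((b : ℤ) - min (b : ℤ) (k : ℤ) - max ((k : ℤ) - (a : ℤ)) 0)) =
      Int.sign ((a : ℤ) - (b : ℤ)) := by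
  rcases lt_trichotomy a b with h | h | h
  · rw [Int.sign_eq_neg_one_of_neg (by omega), Int.sign_eq_neg_one_of_neg (by omega)]
  · subst h
    simp
  · rw [Int.sign_eq_one_of_pos (by omega), Int.sign_eq_one_of_pos (by omega)]
end

section
/- Fix B > 0. For every ε > 0 there exist real numbers g and g′ with |g − g′| ≤ 1 and a sign s ∈ {−1, 1} such that ℙ(M_{B,0}(g′) = s) > exp(ε) · ℙ(M_{B,0}(g) = s). Hence the compressor M_{B,0} (the case β = 0) is not ε-differentially private for any finite ε. -/
/-- The compressor `M_{B,0}` (stochastic sign with privacy budget `β = 0`),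
whose probability of outputting sign `s ∈ {−1,1}` on input `g` is
`(B + s·clip(g,B))/(2B)`, is not `ε`-differentially private for any finite `ε`:
for every `ε > 0` there are inputs `g, g'` with `|g − g'| ≤ 1` and a sign `s`
such that `ℙ(M_{B,0}(g') = s) > exp(ε) · ℙ(M_{B,0}(g) = s)`. -/
theorem beta_zero_not_dp (B : ℝ) (hB : 0 < B) (ε : ℝ) (hε : 0 < ε) :
    ∃ g g' s : ℝ, |g - g'| ≤ 1 ∧ (s = -1 ∨ s = 1) ∧
      (B + s * max (-B) (min B g')) / (2 * B) >
        Real.exp ε * ((B + s * max (-B) (min B g)) / (2 * B)) := by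
  have hδ : 0 < min 1 B := lt_min one_pos hB
  refine ⟨-B, -B + min 1 B, 1, ?_, Or.inr rfl, ?_⟩
  · rw [sub_add_cancel_left, abs_neg, abs_of_pos hδ]
    exact min_le_left 1 B
  · have hδB : min 1 B ≤ B := min_le_right 1 B
    have hg : max (-B) (min B (-B)) = -B := by
      rw [min_eq_right (by linarith), max_self]
    have hg' : max (-B) (min B (-B + min 1 B)) = -B + min 1 B := by
      rw [min_eq_right (by linarith), max_eq_right (by linarith)]
    rw [hg, hg', one_mul, one_mul, add_neg_cancel, zero_div, mul_zero, add_neg_cancel_left]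
    positivity
end

section
/- Let B > 0 and β > 0. For g ∈ ℝ and s ∈ {−1, 1} write q(g, s) = (B + β + s·clip(g, B))/(2B + 2β), the probability that the compressor M_{B,β} applied to g outputs s. Then for all g, g′ ∈ ℝ and all s ∈ {−1, 1}, q(g′, s) ≤ ((2B + β)/β) · q(g, s). In other words, each coordinate of the compressor M_{B,β} is log((2B + β)/β)-differentially private. -/
/-- For `B > 0` and `β > 0`, each coordinate of the stochastic sign compressor `M_{B,β}`
is `log((2B + β)/β)`-differentially private: writing
`q(g, s) = (B + β + s·clip(g,B))/(2B + 2β)`, for all `g, g'` and all signs `s ∈ {−1,1}`,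
`q(g', s) ≤ ((2B + β)/β) · q(g, s)`. -/
theorem compressor_coordinate_dp (B β : ℝ) (hB : 0 < B) (hβ : 0 < β)
    (g g' s : ℝ) (hs : s = -1 ∨ s = 1) :
    (B + β + s * max (-B) (min B g')) / (2 * B + 2 * β) ≤
      ((2 * B + β) / β) * ((B + β + s * max (-B) (min B g)) / (2 * B + 2 * β)) := by
  have clip_mem : ∀ x : ℝ, -B ≤ max (-B) (min B x) ∧ max (-B) (min B x) ≤ B := fun x =>
    ⟨le_max_left _ _, max_le (by linarith) (min_le_left _ _)⟩
  obtain ⟨h1, h2⟩ := clip_mem g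
  obtain ⟨h3, h4⟩ := clip_mem g'
  have upper : B + β + s * max (-B) (min B g') ≤ 2 * B + β := by
    rcases hs with rfl | rfl <;> linarith
  have lower : β ≤ B + β + s * max (-B) (min B g) := by
    rcases hs with rfl | rfl <;> linarith
  rw [← mul_div_assoc]
  refine div_le_div_of_nonneg_right (upper.trans ?_) (by positivity)
  calc 2 * B + β = (2 * B + β) / β * β := by field_simp
    _ ≤ _ := mul_le_mul_of_nonneg_left lower (by positivity)
end

section
/- Let B > 0, β > 0, and d ≥ 1. For g ∈ ℝ and s ∈ {−1, 1} write q(g, s) = (B + β + s·clip(g, B))/(2B + 2β). Then for all vectors g, g′ ∈ ℝ^d with ‖g − g′‖₁ ≤ 1 and all sign vectors s ∈ {−1, 1}^d, ∏_{i=1}^d q(g′_i, s_i) ≤ exp(d · log((2B + β)/β)) · ∏_{i=1}^d q(g_i, s_i). That is, the coordinate-wise independent compressor M_{B,β} on ℝ^d is d·log((2B + β)/β)-differentially private. -/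
open scoped BigOperators

/-- The numerator of a sign probability of the compressor lies between `β` and `2 * B + β`. -/
theorem compressor_numerator_mem_Icc {B : ℝ} (hB : 0 ≤ B) (β x : ℝ) {s : ℝ}
    (hs : s = -1 ∨ s = 1) :
    B + β + s * max (-B) (min B x) ∈ Set.Icc β (2 * B + β) := by
  have hlow : -B ≤ max (-B) (min B x) := le_max_left _ _
  have hupp : max (-B) (min B x) ≤ B := max_le (by linarith) (min_le_left _ _)
  rcases hs with rfl | rfl <;> constructor <;> linarith

/-- The scalar compressor is `log ((2 * B + β) / β)`-differentially private. -/
theorem compressor_scalar_le {B β : ℝ} (hB : 0 ≤ B) (hβ : 0 < β) (x y : ℝ) {s : ℝ}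
    (hs : s = -1 ∨ s = 1) :
    (B + β + s * max (-B) (min B y)) / (2 * B + 2 * β) ≤
      (2 * B + β) / β * ((B + β + s * max (-B) (min B x)) / (2 * B + 2 * β)) := by
  rw [← mul_div_assoc]
  gcongr
  calc
    B + β + s * max (-B) (min B y) ≤ 2 * B + β := (compressor_numerator_mem_Icc hB β y hs).2
    _ = (2 * B + β) / β * β := by field_simp
    _ ≤ (2 * B + β) / β * (B + β + s * max (-B) (min B x)) := by
      gcongr
      exact (compressor_numerator_mem_Icc hB β x hs).1

/-- For `B > 0`, `β > 0`, `d ≥ 1`, the coordinate-wise independent compressor `M_{B,β}` on `ℝ^d`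
is `d·log((2B + β)/β)`-differentially private: writing
`q(g, s) = (B + β + s·clip(g,B))/(2B + 2β)`, for all `g, g' ∈ ℝ^d` with `‖g − g'‖₁ ≤ 1`
and all sign vectors `s ∈ {−1,1}^d`,
`∏ i, q(g'_i, s_i) ≤ exp(d · log((2B + β)/β)) · ∏ i, q(g_i, s_i)`. -/
theorem compressor_vector_dp (B β : ℝ) (hB : 0 < B) (hβ : 0 < β) (d : ℕ) (hd : 1 ≤ d)
    (g g' s : Fin d → ℝ) (hs : ∀ i, s i = -1 ∨ s i = 1)
    (hdist : ∑ i, |g i - g' i| ≤ 1) :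
    ∏ i, (B + β + s i * max (-B) (min B (g' i))) / (2 * B + 2 * β) ≤
      Real.exp ((d : ℝ) * Real.log ((2 * B + β) / β)) *
        ∏ i, (B + β + s i * max (-B) (min B (g i))) / (2 * B + 2 * β) := by
  have hratio : 0 < (2 * B + β) / β := by positivity
  rw [Real.exp_nat_mul, Real.exp_log hratio]
  calc
    _ ≤ ∏ i, (2 * B + β) / β *
        ((B + β + s i * max (-B) (min B (g i))) / (2 * B + 2 * β)) := by
      refine Finset.prod_le_prod (fun i _ => ?_)
        (fun i _ => compressor_scalar_le hB.le hβ (g i) (g' i) (hs i))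
      have hnum := (compressor_numerator_mem_Icc hB.le β (g' i) (hs i)).1
      exact div_nonneg (hβ.le.trans hnum) (by positivity)
    _ = _ := by rw [Finset.prod_mul_distrib, Finset.prod_const, Finset.card_univ, Fintype.card_fin]
end

section
/- Let B > 0 and β > 0. For g ∈ ℝ and s ∈ {−1, 1} write q(g, s) = (B + β + s·clip(g, B))/(2B + 2β). Then for all g, g′ ∈ ℝ with |g − g′| ≤ 1 and all s ∈ {−1, 1}, q(g′, s) ≤ (1 + 1/(β + max(B − |g|, 0))) · q(g, s). Here max(B − |g|, 0) equals the distance dist(g, C_B) from g to the set C_B = (−∞, −B) ∪ (B, ∞). -/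
/-- Clipping to `[-B, B]` does not increase distances. -/
theorem abs_clip_sub_clip_le (B x y : ℝ) :
    |max (-B) (min B x) - max (-B) (min B y)| ≤ |x - y| := by
  refine (abs_max_sub_max_le_max _ _ _ _).trans (max_le (by simp) ?_)
  exact (abs_min_sub_min_le_max _ _ _ _).trans (max_le (by simp) le_rfl)

/-- The clipped value stays at distance `max (B - |x|) 0` from `±B`. -/
theorem max_sub_abs_zero_le_sub_abs_clip {B : ℝ} (hB : 0 ≤ B) (x : ℝ) :
    max (B - |x|) 0 ≤ B - |max (-B) (min B x)| := by
  have h_lip := abs_clip_sub_clip_le B x 0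
  rw [min_eq_right hB, max_eq_right (neg_nonpos.2 hB), sub_zero, sub_zero] at h_lip
  have h_le : |max (-B) (min B x)| ≤ B :=
    abs_le.2 ⟨le_max_left _ _, max_le (by linarith) (min_le_left _ _)⟩
  exact max_le (by linarith) (by linarith)

/-- Finer coordinate-wise differential privacy of `M_{B,β}`: writing
`q(g, s) = (B + β + s·clip(g,B))/(2B + 2β)`, for all `g, g'` with `|g − g'| ≤ 1` and
all signs `s ∈ {−1,1}`, `q(g', s) ≤ (1 + 1/(β + dist(g, C_B))) · q(g, s)`, where
`dist(g, C_B) = max(B − |g|, 0)` is the distance from `g` to `C_B = (−∞,−B) ∪ (B,∞)`. -/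
theorem compressor_coordinate_dp_fine (B β : ℝ) (hB : 0 < B) (hβ : 0 < β)
    (g g' s : ℝ) (hdist : |g - g'| ≤ 1) (hs : s = -1 ∨ s = 1) :
    (B + β + s * max (-B) (min B g')) / (2 * B + 2 * β) ≤
      (1 + 1 / (β + max (B - |g|) 0)) *
        ((B + β + s * max (-B) (min B g)) / (2 * B + 2 * β)) := by
  have h_lip := (abs_clip_sub_clip_le B g g').trans hdist
  have h_gap := max_sub_abs_zero_le_sub_abs_clip hB.le g
  have hd : 0 < β + max (B - |g|) 0 := add_pos_of_pos_of_nonneg hβ (le_max_right _ _)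
  generalize max (-B) (min B g) = c at *
  generalize max (-B) (min B g') = c' at *
  generalize max (B - |g|) 0 = d at *
  have h_step : s * c' - s * c ≤ 1 := by
    rcases hs with rfl | rfl <;> linarith [abs_le.1 h_lip]
  have h_lower : β + d ≤ B + β + s * c := by
    rcases hs with rfl | rfl <;> linarith [le_abs_self c, neg_abs_le c]
  have h_one : 1 ≤ 1 / (β + d) * (B + β + s * c) := by
    rw [one_div_mul_eq_div]
    exact (one_le_div hd).2 h_lower
  rw [← mul_div_assoc]
  gcongr
  linarith
end

section
/- Let s > 0, B > 0, and g ∈ ℝ with |g| < B, and let X be a real random variable with Gaussian law of mean g and variance s² (gaussianReal g s²). Then E[clip(X, B)] − g ≤ (s³ / (√(2π) · ((B + g)² + s²))) · exp(−(B + g)²/(2s²)); that is, the clipping bias of a Gaussian random variable whose mean lies strictly inside the clipping interval is exponentially small in (B + g)²/s². -/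
open MeasureTheory ProbabilityTheory

lemma hasDerivAt_exp_mul_one_sub_div (a y : ℝ) :
    HasDerivAt (fun y : ℝ => Real.exp (-y ^ 2 / 2) * (1 - a * y / (1 + y ^ 2)))
      (-(Real.exp (-y ^ 2 / 2) * ((y - a) + 2 * a / (1 + y ^ 2) ^ 2))) y := by
  have hne : (1 + y ^ 2) ≠ 0 := by positivity
  have h1 : HasDerivAt (fun y : ℝ => Real.exp (-y ^ 2 / 2)) (Real.exp (-y ^ 2 / 2) * (-y)) y := by
    refine (((hasDerivAt_pow 2 y).fun_neg).div_const 2).exp.congr_deriv ?_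
    norm_num
    ring
  have h2 : HasDerivAt (fun y : ℝ => 1 - a * y / (1 + y ^ 2))
      (-((a * 1 * (1 + y ^ 2) - a * y * (2 * y)) / (1 + y ^ 2) ^ 2)) y := by
    have h3 : HasDerivAt (fun y : ℝ => 1 + y ^ 2) (2 * y) y := by
      simpa using (hasDerivAt_pow 2 y).const_add 1
    exact (((hasDerivAt_id y).const_mul a).div h3 hne).const_sub 1
  refine (h1.fun_mul h2).congr_deriv ?_
  field_simp
  ring

lemma tendsto_exp_mul_one_sub_div_atTop (a : ℝ) :
    Filter.Tendsto (fun y : ℝ => Real.exp (-y ^ 2 / 2) * (1 - a * y / (1 + y ^ 2)))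
      Filter.atTop (nhds 0) := by
  have h1 : Filter.Tendsto (fun y : ℝ => Real.exp (-y ^ 2 / 2)) Filter.atTop (nhds 0) := by
    refine Real.tendsto_exp_atBot.comp ?_
    have h := (Filter.tendsto_pow_atTop (α := ℝ) two_ne_zero).atTop_div_const two_pos
    refine (Filter.tendsto_neg_atTop_atBot.comp h).congr fun y => ?_
    simp [neg_div]
  refine h1.zero_mul_isBoundedUnder_le ?_
  refine Filter.isBoundedUnder_of ⟨1 + |a|, fun y => ?_⟩
  have hy : |y| / (1 + y ^ 2) ≤ 1 := by
    rw [div_le_one (by positivity)]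
    nlinarith [sq_nonneg (|y| - 1), sq_abs y]
  calc ‖1 - a * y / (1 + y ^ 2)‖ ≤ ‖(1 : ℝ)‖ + ‖a * y / (1 + y ^ 2)‖ := norm_sub_le _ _
    _ = 1 + |a| * (|y| / (1 + y ^ 2)) := by
        rw [Real.norm_eq_abs, Real.norm_eq_abs, abs_one, abs_div, abs_mul,
          abs_of_pos (show (0 : ℝ) < 1 + y ^ 2 by positivity), mul_div_assoc]
    _ ≤ 1 + |a| := by nlinarith [abs_nonneg a]

lemma integral_Ioi_sub_mul_exp_le {a : ℝ} (ha : 0 ≤ a) :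
    ∫ y in Set.Ioi a, (y - a) * Real.exp (-y ^ 2 / 2) ≤ Real.exp (-a ^ 2 / 2) / (1 + a ^ 2) := by
  have hnonpos : ∀ y ∈ Set.Ioi a,
      -(Real.exp (-y ^ 2 / 2) * ((y - a) + 2 * a / (1 + y ^ 2) ^ 2)) ≤ 0 := by
    intro y hy
    have : 0 ≤ y - a := sub_nonneg.2 (le_of_lt hy)
    rw [neg_nonpos]
    positivity
  have hint := integrableOn_Ioi_deriv_of_nonpos'
    (fun y _ => hasDerivAt_exp_mul_one_sub_div a y) hnonpos (tendsto_exp_mul_one_sub_div_atTop a)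
  have heq := integral_Ioi_of_hasDerivAt_of_tendsto'
    (fun y _ => hasDerivAt_exp_mul_one_sub_div a y) hint (tendsto_exp_mul_one_sub_div_atTop a)
  rw [integral_neg] at heq
  calc _ ≤ ∫ y in Set.Ioi a, Real.exp (-y ^ 2 / 2) * ((y - a) + 2 * a / (1 + y ^ 2) ^ 2) := by
        refine integral_mono_of_nonneg ?_ ?_ ?_
        · filter_upwards [ae_restrict_mem measurableSet_Ioi] with y hy
          exact mul_nonneg (sub_nonneg.2 (le_of_lt hy)) (Real.exp_pos _).le
        · simpa [IntegrableOn] using hint.fun_neg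
        · refine Filter.Eventually.of_forall fun y => ?_
          have : 0 ≤ Real.exp (-y ^ 2 / 2) * (2 * a / (1 + y ^ 2) ^ 2) := by positivity
          dsimp only
          linarith
    _ = Real.exp (-a ^ 2 / 2) * (1 - a * a / (1 + a ^ 2)) := by linarith
    _ = _ := by
        field_simp
        ring

lemma integral_max_sub_gaussianReal_le {a : ℝ} (ha : 0 ≤ a) :
    ∫ y, max (y - a) 0 ∂(gaussianReal 0 1) ≤
      Real.exp (-a ^ 2 / 2) / (Real.sqrt (2 * Real.pi) * (1 + a ^ 2)) := by
  rw [integral_gaussianReal_eq_integral_smul one_ne_zero]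
  have h : (fun y : ℝ => gaussianPDFReal 0 1 y • max (y - a) 0) =
      (Set.Ioi a).indicator
        (fun y => (Real.sqrt (2 * Real.pi))⁻¹ * ((y - a) * Real.exp (-y ^ 2 / 2))) := by
    ext y
    by_cases hy : a < y
    · simp [gaussianPDFReal, Set.indicator, hy, max_eq_left (sub_nonneg.2 hy.le)]
      ring
    · simp [Set.indicator, hy, not_lt.1 hy]
  rw [h, integral_indicator measurableSet_Ioi, integral_const_mul]
  calc _ ≤ (Real.sqrt (2 * Real.pi))⁻¹ * (Real.exp (-a ^ 2 / 2) / (1 + a ^ 2)) := by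
        gcongr
        exact integral_Ioi_sub_mul_exp_le ha
    _ = _ := by
        field_simp

/-- Clipping bias of a Gaussian: if `X ~ N(g, s²)` with `|g| < B`, then
`E[clip(X, B)] − g ≤ (s³/(√(2π)·((B+g)² + s²))) · exp(−(B+g)²/(2s²))`. -/
theorem gaussian_clip_bias (s B g : ℝ) (hs : 0 < s) (hB : 0 < B) (hg : |g| < B) :
    (∫ x, max (-B) (min B x) ∂(gaussianReal g (Real.toNNReal (s ^ 2)))) - g ≤
      (s ^ 3 / (Real.sqrt (2 * Real.pi) * ((B + g) ^ 2 + s ^ 2))) *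
        Real.exp (-(B + g) ^ 2 / (2 * s ^ 2)) := by
  have hc : 0 < B + g := by linarith [(abs_lt.1 hg).1]
  have hmap : gaussianReal g (Real.toNNReal (s ^ 2)) =
      (gaussianReal 0 1).map (fun y => g + -s * y) := by
    have h : (fun y : ℝ => g + -s * y) = (fun y => g + y) ∘ (fun y => -s * y) := rfl
    rw [h, ← Measure.map_map (by fun_prop) (by fun_prop), gaussianReal_map_const_mul,
      gaussianReal_map_const_add]
    congr 1
    · simp
    · ext
      simp [sq_nonneg]
  rw [hmap, integral_map (by fun_prop) (by fun_prop)]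
  have hid : Integrable (fun y : ℝ => y) (gaussianReal 0 1) :=
    (memLp_id_gaussianReal 1).integrable (by simp)
  have hmax : Integrable (fun y : ℝ => max (y - (B + g) / s) 0) (gaussianReal 0 1) :=
    (hid.sub (integrable_const _)).pos_part
  have hlin : Integrable (fun y : ℝ => g + -s * y) (gaussianReal 0 1) :=
    (integrable_const _).add (hid.const_mul _)
  have hclip : Integrable (fun y : ℝ => max (-B) (min B (g + -s * y))) (gaussianReal 0 1) :=
    (integrable_const _).sup ((integrable_const _).inf hlin)
  have hle : ∫ y, max (-B) (min B (g + -s * y)) ∂(gaussianReal 0 1) ≤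
      ∫ y, ((g + -s * y) + s * max (y - (B + g) / s) 0) ∂(gaussianReal 0 1) := by
    refine integral_mono hclip (hlin.add (hmax.const_mul s)) fun y => ?_
    have h0 : 0 ≤ s * max (y - (B + g) / s) 0 := mul_nonneg hs.le (le_max_right _ _)
    have h1 : s * (y - (B + g) / s) ≤ s * max (y - (B + g) / s) 0 :=
      mul_le_mul_of_nonneg_left (le_max_left _ _) hs.le
    have h2 : s * (y - (B + g) / s) = s * y - (B + g) := by field_simp
    refine max_le ?_ ((min_le_right _ _).trans ?_) <;> linarith
  rw [integral_add hlin (hmax.const_mul s), integral_add (integrable_const _) (hid.const_mul _),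
    integral_const_mul, integral_const_mul, integral_id_gaussianReal] at hle
  have hbound := mul_le_mul_of_nonneg_left
    (integral_max_sub_gaussianReal_le (div_nonneg hc.le hs.le)) hs.le
  have hfin : s * (Real.exp (-((B + g) / s) ^ 2 / 2) /
      (Real.sqrt (2 * Real.pi) * (1 + ((B + g) / s) ^ 2))) =
      (s ^ 3 / (Real.sqrt (2 * Real.pi) * ((B + g) ^ 2 + s ^ 2))) *
        Real.exp (-(B + g) ^ 2 / (2 * s ^ 2)) := by
    have he : -((B + g) / s) ^ 2 / 2 = -(B + g) ^ 2 / (2 * s ^ 2) := by field_simp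
    have hd : 1 + ((B + g) / s) ^ 2 = ((B + g) ^ 2 + s ^ 2) / s ^ 2 := by
      field_simp
      ring
    rw [he, hd]
    field_simp
  rw [hfin] at hbound
  rw [integral_const, probReal_univ, one_smul, mul_zero] at hle
  linarith
end

section
/- Let σ > 0, B₀ > 0, ε₀ > σ/B₀, set B = (1 + ε₀)·B₀, let β ≥ 0, and let n ≥ 1 be a natural number. Let Y be an integrable real random variable with mean g = E[Y] satisfying |g| ≤ B₀, and with two-sided sub-Gaussian tails: ℙ(Y − g ≥ t) ≤ exp(−n·t²/(2σ²)) and ℙ(Y − g ≤ −t) ≤ exp(−n·t²/(2σ²)) for all t > 0. Then E[clip(Y, B)] ≤ g + (2B + 2β) · exp(−n/2). -/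
open MeasureTheory

/-- A nonnegative integrable function whose tail is dominated by `C * exp (-s / σ)` has integral
at most `C * σ`. -/
lemma integral_le_of_meas_le_exp {Ω : Type*} {mΩ : MeasurableSpace Ω} {μ : Measure Ω}
    {σ C : ℝ} (hσ : 0 < σ) {f : Ω → ℝ} (hf : Integrable f μ)
    (hf0 : ∀ ω, 0 ≤ f ω) (h : ∀ s > 0, μ.real {ω | s ≤ f ω} ≤ C * Real.exp (-σ⁻¹ * s)) :
    ∫ ω, f ω ∂μ ≤ C * σ := by
  have hneg : -σ⁻¹ < 0 := neg_neg_of_pos (inv_pos.mpr hσ)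
  rw [hf.integral_eq_integral_meas_le (Filter.Eventually.of_forall hf0)]
  calc ∫ s in Set.Ioi 0, μ.real {ω | s ≤ f ω}
      ≤ ∫ s in Set.Ioi 0, C * Real.exp (-σ⁻¹ * s) := by
        refine integral_mono_of_nonneg (Filter.Eventually.of_forall fun s => measureReal_nonneg)
          ((integrableOn_exp_mul_Ioi hneg 0).const_mul C) ?_
        filter_upwards [ae_restrict_mem measurableSet_Ioi] with s hs using h s hs
    _ = C * σ := by
        rw [integral_const_mul, integral_exp_mul_Ioi hneg]
        simp

/-- Past the level `σ`, a Gaussian tail is dominated by an exponential one. -/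
lemma exp_neg_sq_le {σ s t : ℝ} {n : ℕ} (hσ : 0 < σ) (hn : 1 ≤ n) (hs : 0 ≤ s)
    (ht : σ + s ≤ t) :
    Real.exp (-((n : ℝ) * t ^ 2) / (2 * σ ^ 2)) ≤
      Real.exp (-(n : ℝ) / 2) * Real.exp (-σ⁻¹ * s) := by
  have hn' : (1 : ℝ) ≤ n := by exact_mod_cast hn
  rw [← Real.exp_add, Real.exp_le_exp, div_le_iff₀ (by positivity)]
  have hsq : σ ^ 2 + 2 * σ * s ≤ t ^ 2 := by nlinarith
  have hmul := mul_le_mul_of_nonneg_left hsq (zero_le_one.trans hn')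
  have hns : 0 ≤ (n - 1) * (σ * s) := mul_nonneg (sub_nonneg.mpr hn') (by positivity)
  have hrhs : (-(n : ℝ) / 2 + -σ⁻¹ * s) * (2 * σ ^ 2) = -n * σ ^ 2 - 2 * σ * s := by
    field_simp
    ring
  rw [hrhs]
  nlinarith

/-- Clipping bias of a sub-Gaussian random variable: if `Y` is integrable with mean
`g = E[Y]`, `|g| ≤ B₀`, `B = (1 + ε₀)·B₀` with `ε₀ > σ/B₀`, and `Y − g` has two-sided
sub-Gaussian tails `exp(−n·t²/(2σ²))`, then `E[clip(Y, B)] ≤ g + (2B + 2β)·exp(−n/2)`. -/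
theorem subgaussian_clip_mean_le {Ω : Type*} {mΩ : MeasurableSpace Ω} (μ : Measure Ω)
    [IsProbabilityMeasure μ] (σ B₀ ε₀ β : ℝ) (n : ℕ)
    (hσ : 0 < σ) (hB₀ : 0 < B₀) (hε₀ : σ / B₀ < ε₀) (hβ : 0 ≤ β) (hn : 1 ≤ n)
    (Y : Ω → ℝ) (hint : Integrable Y μ) (hg : |∫ ω, Y ω ∂μ| ≤ B₀)
    (htail₁ : ∀ t > 0, μ {ω | t ≤ Y ω - ∫ ω', Y ω' ∂μ} ≤
      ENNReal.ofReal (Real.exp (-((n : ℝ) * t ^ 2) / (2 * σ ^ 2))))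
    (htail₂ : ∀ t > 0, μ {ω | Y ω - ∫ ω', Y ω' ∂μ ≤ -t} ≤
      ENNReal.ofReal (Real.exp (-((n : ℝ) * t ^ 2) / (2 * σ ^ 2)))) :
    ∫ ω, max (-((1 + ε₀) * B₀)) (min ((1 + ε₀) * B₀) (Y ω)) ∂μ ≤
      (∫ ω, Y ω ∂μ) + (2 * ((1 + ε₀) * B₀) + 2 * β) * Real.exp (-(n : ℝ) / 2) := by
  set g := ∫ ω, Y ω ∂μ
  set B := (1 + ε₀) * B₀ with hB
  have hσB : σ < B - B₀ := by
    have := (div_lt_iff₀ hB₀).mp hε₀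
    rw [hB]
    linarith
  have hgB := neg_le_of_abs_le hg
  have hZ : Integrable (fun ω => max 0 (-B - Y ω)) μ :=
    (integrable_zero Ω ℝ μ).sup ((integrable_const (-B)).sub hint)
  have hclip : Integrable (fun ω => max (-B) (min B (Y ω))) μ :=
    (integrable_const (-B)).sup ((integrable_const B).inf hint)
  have hbound : ∫ ω, max 0 (-B - Y ω) ∂μ ≤ Real.exp (-(n : ℝ) / 2) * σ := by
    refine integral_le_of_meas_le_exp hσ hZ (fun ω => le_max_left _ _) fun s hs => ?_
    refine le_trans ?_ (exp_neg_sq_le hσ hn hs.le (t := B + g + s) (by linarith))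
    refine ENNReal.toReal_le_of_le_ofReal (Real.exp_nonneg _)
      (le_trans (measure_mono fun ω hω => ?_) (htail₂ (B + g + s) (by linarith)))
    simp only [Set.mem_ofPred_eq] at hω ⊢
    rcases le_max_iff.mp hω with h | h <;> linarith
  have hle : ∫ ω, max (-B) (min B (Y ω)) ∂μ ≤ ∫ ω, (Y ω + max 0 (-B - Y ω)) ∂μ := by
    refine integral_mono hclip (hint.add hZ) fun ω => max_le ?_ ?_
    · linarith [le_max_right 0 (-B - Y ω)]
    · linarith [le_max_left 0 (-B - Y ω), min_le_right B (Y ω)]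
  rw [integral_add hint hZ] at hle
  have hexp : Real.exp (-(n : ℝ) / 2) * σ ≤ (2 * B + 2 * β) * Real.exp (-(n : ℝ) / 2) := by
    rw [mul_comm]
    exact mul_le_mul_of_nonneg_right (by linarith) (Real.exp_nonneg _)
  linarith
end
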